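/- arXiv:2409.18250 — 2 statements merged into one kernel-verified Lean document; each statement's English description precedes it below -/
import Mathlib

section
/- Every edge 2-coloured graph G admits a covering set of at most α(G) monochromatic subgraphs of bounded diameter, where the bound depends only on α(G); in particular, for α(G)=2 one may take each subgraph to have diameter at most 8·4+12·2+4 = 60. -/
/-- A scale-indexed closeness relation with the laws of `dist x y ≤ n` for a metric. -/
structure IsCloseness {V : Type*} (N : ℕ → V → V → Prop) : Prop where
  refl : ∀ x, N 0 x x
  symm : ∀ {n x y}, N n x y → N n y x
  trans : ∀ {m n x y z}, N m x y → N n y z → N (m + n) x z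
  mono : ∀ {m n x y}, m ≤ n → N m x y → N n x y

namespace IsCloseness

variable {V : Type*} {R B : ℕ → V → V → Prop}

/-- A finite set is `r`-separated if its points are pairwise at distance more than `r` with
respect to both relations. -/
def Separated (R B : ℕ → V → V → Prop) (r : ℕ) (T : Finset V) : Prop :=
  ∀ x ∈ T, ∀ y ∈ T, x ≠ y → ¬ R r x y ∧ ¬ B r x y

lemma far (hR : IsCloseness R) {m n p : ℕ} {x y z : V} (hxz : ¬ R p x z) (hxy : R m x y)
    (h : m + n ≤ p) : ¬ R n y z :=
  fun hyz => hxz (hR.mono h (hR.trans hxy hyz))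

/-- A separated family indexed by `S`, extended by one further separated point, violates an upper
bound `S.card` on the sizes of separated sets. -/
lemma not_separated_extension (hR : IsCloseness R) (hB : IsCloseness B) {r : ℕ} {S : Finset V}
    (hmax : ∀ T, Separated R B r T → T.card ≤ S.card) (u : V → V) (w : V)
    (hu : ∀ x ∈ S, ∀ y ∈ S, x ≠ y → ¬ R r (u x) (u y) ∧ ¬ B r (u x) (u y))
    (hw : ∀ x ∈ S, ¬ R r w (u x) ∧ ¬ B r w (u x)) : False := by
  classical
  have hinj : Set.InjOn u S := by
    intro x hx y hy hxy
    by_contra hne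
    apply (hu x hx y hy hne).1
    rw [hxy]
    exact hR.mono (Nat.zero_le _) (hR.refl _)
  have hwn : w ∉ S.image u := by
    intro h
    obtain ⟨x, hx, rfl⟩ := Finset.mem_image.1 h
    exact (hw x hx).1 (hR.mono (Nat.zero_le _) (hR.refl _))
  have hsep : Separated R B r (insert w (S.image u)) := by
    intro x hx y hy hxy
    rcases Finset.mem_insert.1 hx with rfl | hx' <;>
      rcases Finset.mem_insert.1 hy with rfl | hy'
    · exact absurd rfl hxy
    · obtain ⟨b, hb, rfl⟩ := Finset.mem_image.1 hy'
      exact hw b hb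
    · obtain ⟨a, ha, rfl⟩ := Finset.mem_image.1 hx'
      exact ⟨fun h => (hw a ha).1 (hR.symm h), fun h => (hw a ha).2 (hB.symm h)⟩
    · obtain ⟨a, ha, rfl⟩ := Finset.mem_image.1 hx'
      obtain ⟨b, hb, rfl⟩ := Finset.mem_image.1 hy'
      exact hu a ha b hb fun h => hxy (by rw [h])
  have := hmax _ hsep
  rw [Finset.card_insert_of_notMem hwn, Finset.card_image_of_injOn hinj] at this
  omega

open Classical in
/-- The points of `S` reachable by alternating paths with at most the given number of steps, the
tolerance decreasing with every step. -/
noncomputable def reach (R B : ℕ → V → V → Prop) (r : ℕ) (S : Finset V) : ℕ → Finset V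
  | 0 => ∅
  | l + 1 => S.filter fun s =>
      ∃ w, B r s w ∧ ∀ x ∈ S, x ∉ reach R B r S l → ¬ R ((S.card + 1 - l) * r) x w

lemma mem_reach_succ {r : ℕ} {S : Finset V} {l : ℕ} {s : V} :
    s ∈ reach R B r S (l + 1) ↔ s ∈ S ∧
      ∃ w, B r s w ∧ ∀ x ∈ S, x ∉ reach R B r S l → ¬ R ((S.card + 1 - l) * r) x w := by
  simp [reach]

lemma reach_subset (r : ℕ) (S : Finset V) (l : ℕ) : reach R B r S l ⊆ S := by
  cases l with
  | zero => simp [reach]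
  | succ l => exact fun s hs => (mem_reach_succ.1 hs).1

lemma reach_subset_succ (hR : IsCloseness R) (r : ℕ) (S : Finset V) (l : ℕ) :
    reach R B r S l ⊆ reach R B r S (l + 1) := by
  induction l with
  | zero => simp [reach]
  | succ l ih =>
    intro s hs
    obtain ⟨hsS, w, hw, hfar⟩ := mem_reach_succ.1 hs
    refine mem_reach_succ.2 ⟨hsS, w, hw, fun x hx hxl h => hfar x hx (fun h' => hxl (ih h')) ?_⟩
    exact hR.mono (Nat.mul_le_mul_right r (by omega)) h

lemma exists_reach_eq_succ (hR : IsCloseness R) (r : ℕ) (S : Finset V) :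
    ∃ l ≤ S.card, reach R B r S l = reach R B r S (l + 1) := by
  by_contra! h
  have key : ∀ l ≤ S.card + 1, l ≤ (reach R B r S l).card := by
    intro l
    induction l with
    | zero => simp
    | succ l ih =>
      intro hl
      have h1 := ih (by omega)
      have h2 := Finset.card_lt_card
        ((reach_subset_succ (B := B) hR r S l).ssubset_of_ne (h l (by omega)))
      omega
  have h1 := key _ le_rfl
  have h2 := Finset.card_le_card (reach_subset (R := R) (B := B) r S (S.card + 1))
  omega

/-- Exchanging along an alternating path ending in a reachable point `s`: each `x ∈ S` is moved to
a point `u x` near `x` with respect to `B`, and with respect to `R` all moved points but one root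
are near distinct points `a x ≠ s` of `S`, while the root is far from `S`. -/
lemma exists_exchange (hR : IsCloseness R) (hB : IsCloseness B) {r : ℕ} {S : Finset V} (l : ℕ)
    (hl : l ≤ S.card) (s : V) (hs : s ∈ reach R B r S l) :
    ∃ (d : ℕ) (u a : V → V) (ρ : V), (S.card + 1 - l) * r ≤ d ∧ d ≤ S.card * r ∧
      (∀ x ∈ S, B r x (u x)) ∧
      (∀ x ∈ S, ¬ R (d + r) x (u ρ)) ∧
      (∀ x ∈ S, x ≠ ρ → a x ∈ S ∧ a x ≠ s ∧ R d (a x) (u x)) ∧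
      (∀ x ∈ S, ∀ y ∈ S, x ≠ ρ → y ≠ ρ → a x = a y → x = y) ∧
      (∀ x, x ∉ reach R B r S l → u x = x ∧ a x = x) := by
  classical
  induction l generalizing s with
  | zero => simp [reach] at hs
  | succ l ih =>
    have hmul : (S.card + 1 - (l + 1)) * r ≤ (S.card + 1 - l) * r :=
      Nat.mul_le_mul_right r (by omega)
    have hsub := reach_subset_succ (B := B) hR r S l
    by_cases hsl : s ∈ reach R B r S l
    · obtain ⟨d, u, a, ρ, h1, h2, h3, h4, h5, h6, h7⟩ := ih (by omega) s hsl
      exact ⟨d, u, a, ρ, hmul.trans h1, h2, h3, h4, h5, h6, fun x hx => h7 x fun h => hx (hsub h)⟩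
    obtain ⟨hsS, v, hv, hfar⟩ := mem_reach_succ.1 hs
    by_cases hall : ∀ x ∈ S, ¬ R ((S.card + 1 - l) * r) x v
    · refine ⟨(S.card - l) * r, Function.update id s v, id, s, ?_, ?_, ?_, ?_, ?_, ?_, ?_⟩
      · exact Nat.mul_le_mul_right r (by omega)
      · exact Nat.mul_le_mul_right r (by omega)
      · intro x _
        by_cases hx : x = s
        · subst hx; simpa using hv
        · simpa [hx] using hB.mono (Nat.zero_le _) (hB.refl x)
      · intro x hx
        have : (S.card - l) * r + r = (S.card + 1 - l) * r := by
          rw [← Nat.succ_mul]; congr 1; omega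
        simpa [this] using hall x hx
      · intro x hx hxs
        simpa [hxs, hx] using hR.mono (Nat.zero_le _) (hR.refl x)
      · intro x _ y _ _ _ h
        exact h
      · intro x hx
        have : x ≠ s := fun h => hx (h ▸ hs)
        simp [this]
    · push Not at hall
      obtain ⟨s', hs'S, hs'⟩ := hall
      have hs'l : s' ∈ reach R B r S l := by
        by_contra h
        exact hfar s' hs'S h hs'
      obtain ⟨d, u, a, ρ, h1, h2, h3, h4, h5, h6, h7⟩ := ih (by omega) s' hs'l
      obtain ⟨hus, has⟩ := h7 s hsl
      have hρ : s ≠ ρ := by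
        rintro rfl
        apply h4 s hsS
        rw [hus]
        exact hR.mono (Nat.zero_le _) (hR.refl s)
      refine ⟨d, Function.update u s v, Function.update a s s', ρ, hmul.trans h1, h2,
        ?_, ?_, ?_, ?_, ?_⟩
      · intro x hx
        by_cases hxs : x = s
        · subst hxs; simpa using hv
        · simpa [hxs] using h3 x hx
      · intro x hx
        simpa [hρ.symm] using h4 x hx
      · intro x hx hxρ
        by_cases hxs : x = s
        · subst hxs
          simp only [Function.update_self]
          exact ⟨hs'S, fun h => hsl (h ▸ hs'l), hR.mono h1 hs'⟩
        · obtain ⟨g1, g2, g3⟩ := h5 x hx hxρ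
          simp only [Function.update_of_ne hxs]
          exact ⟨g1, fun h => hxs (h6 x hx s hsS hxρ hρ (h.trans has.symm)), g3⟩
      · intro x hx y hy hxρ hyρ h
        by_cases hxs : x = s <;> by_cases hys : y = s
        · rw [hxs, hys]
        · subst hxs
          simp only [Function.update_self, Function.update_of_ne hys] at h
          exact absurd h.symm (h5 y hy hyρ).2.1
        · subst hys
          simp only [Function.update_self, Function.update_of_ne hxs] at h
          exact absurd h (h5 x hx hxρ).2.1
        · simp only [Function.update_of_ne hxs, Function.update_of_ne hys] at h
          exact h6 x hx y hy hxρ hyρ h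
      · intro x hx
        have hxs : x ≠ s := fun h => hx (h ▸ hs)
        simpa [hxs] using h7 x fun h => hx (hsub h)

/-- If `S` is widely separated and no larger set is even `r`-separated, then balls of radius
comparable to `r` around the points of `S` cover everything, with one relation per point. -/
lemma exists_cover_of_separated (hR : IsCloseness R) (hB : IsCloseness B) {r : ℕ} {S : Finset V}
    (hS : 1 ≤ S.card) (hsep : Separated R B ((2 * S.card + 1) * r) S)
    (hmax : ∀ T, Separated R B r T → T.card ≤ S.card) :
    ∃ C D : Finset V, C.card + D.card ≤ S.card ∧
      ∀ v, (∃ c ∈ C, R ((S.card + 1) * r) c v) ∨ (∃ c ∈ D, B ((S.card + 1) * r) c v) := by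
  classical
  obtain ⟨l, hl, hZ⟩ := exists_reach_eq_succ (B := B) hR r S
  have hZS := reach_subset (R := R) (B := B) r S l
  have hr : r ≤ S.card * r := Nat.le_mul_of_pos_left r hS
  have hsum : (2 * S.card + 1) * r = 2 * (S.card * r) + r := by ring
  have hρ : (S.card + 1) * r = S.card * r + r := by ring
  rw [hsum] at hsep
  refine ⟨S \ reach R B r S l, reach R B r S l, ?_, ?_⟩
  · rw [Finset.card_sdiff_add_card_eq_card hZS]
  intro w
  by_contra! hcon
  rw [hρ] at hcon
  obtain ⟨hwR, hwB⟩ := hcon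
  have hwR' : ∀ x ∈ S, x ∉ reach R B r S l → ¬ R (S.card * r + r) x w := fun x hx hxl =>
    hwR x (Finset.mem_sdiff.2 ⟨hx, hxl⟩)
  have hwBS : ∀ x ∈ S, ¬ B r x w := by
    intro x hx hxw
    refine hwB x ?_ (hB.mono (by omega) hxw)
    rw [hZ]
    refine mem_reach_succ.2 ⟨hx, w, hxw, fun y hy hyl h => hwR' y hy hyl (hR.mono ?_ h)⟩
    rw [← hρ]
    exact Nat.mul_le_mul_right r (by omega)
  obtain ⟨s, hsS, hsw⟩ : ∃ s ∈ S, R r s w := by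
    by_contra! hno
    refine not_separated_extension hR hB hmax id w (fun x hx y hy hxy => ?_) fun x hx =>
      ⟨fun h => hno x hx (hR.symm h), fun h => hwBS x hx (hB.symm h)⟩
    have := hsep x hx y hy hxy
    exact ⟨fun h => this.1 (hR.mono (by omega) h), fun h => this.2 (hB.mono (by omega) h)⟩
  have hsl : s ∈ reach R B r S l := by
    by_contra h
    exact hwR' s hsS h (hR.mono (by omega) hsw)
  obtain ⟨d, u, a, ρ, h1, h2, h3, h4, h5, h6, h7⟩ := exists_exchange hR hB l hl s hsl
  have hrd : r ≤ d := (Nat.le_mul_of_pos_left r (by omega)).trans h1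
  have hroot : ∀ x ∈ S, x ≠ ρ → ¬ R r (u x) (u ρ) := fun x hx hxρ =>
    have ⟨g1, _, g3⟩ := h5 x hx hxρ
    hR.far (h4 _ g1) g3 le_rfl
  refine not_separated_extension hR hB hmax u w (fun x hx y hy hxy => ⟨?_, ?_⟩)
    fun x hx => ⟨?_, ?_⟩
  · by_cases hxρ : x = ρ
    · subst hxρ
      exact fun h => hroot y hy hxy.symm (hR.symm h)
    by_cases hyρ : y = ρ
    · subst hyρ
      exact hroot x hx hxρ
    obtain ⟨gx1, _, gx3⟩ := h5 x hx hxρ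
    obtain ⟨gy1, _, gy3⟩ := h5 y hy hyρ
    have := (hsep _ gx1 _ gy1 fun h => hxy (h6 x hx y hy hxρ hyρ h)).1
    exact fun h => this (hR.mono (by omega) (hR.trans (hR.trans gx3 h) (hR.symm gy3)))
  · exact fun h => (hsep x hx y hy hxy).2
      (hB.mono (by omega) (hB.trans (hB.trans (h3 x hx) h) (hB.symm (h3 y hy))))
  · by_cases hxρ : x = ρ
    · subst hxρ
      exact hR.far (h4 s hsS) hsw (by omega)
    · obtain ⟨g1, g2, g3⟩ := h5 x hx hxρ
      exact fun h => (hsep s hsS _ g1 g2.symm).1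
        (hR.mono (by omega) (hR.trans (hR.trans hsw h) (hR.symm g3)))
  · intro h
    by_cases hxl : x ∈ reach R B r S l
    · exact hwB x hxl (hB.mono (by omega) (hB.trans (h3 x hx) (hB.symm h)))
    · rw [(h7 x hxl).1] at h
      exact hwBS x hx (hB.symm h)

/-- The radius of the covering balls when `r`-separated sets have at most `k` points. -/
def coverRadius : ℕ → ℕ → ℕ
  | 0, _ => 0
  | k + 1, r => max ((k + 2) * r) (coverRadius k ((2 * (k + 1) + 1) * r))

theorem exists_cover (hR : IsCloseness R) (hB : IsCloseness B) (k r : ℕ)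
    (hmax : ∀ T, Separated R B r T → T.card ≤ k) :
    ∃ C D : Finset V, C.card + D.card ≤ k ∧
      ∀ v, (∃ c ∈ C, R (coverRadius k r) c v) ∨ (∃ c ∈ D, B (coverRadius k r) c v) := by
  induction k generalizing r with
  | zero =>
    refine ⟨∅, ∅, by simp, fun v => ?_⟩
    have : Separated R B r {v} := by
      intro x hx y hy hxy
      simp_all
    have := hmax _ this
    simp at this
  | succ k ih =>
    by_cases h : ∀ T, Separated R B ((2 * (k + 1) + 1) * r) T → T.card ≤ k
    · obtain ⟨C, D, hcard, hcov⟩ := ih _ h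
      refine ⟨C, D, by omega, fun v => (hcov v).imp ?_ ?_⟩
      · exact fun ⟨c, hc, h⟩ => ⟨c, hc, hR.mono (le_max_right _ _) h⟩
      · exact fun ⟨c, hc, h⟩ => ⟨c, hc, hB.mono (le_max_right _ _) h⟩
    · push Not at h
      obtain ⟨S, hS, hcard⟩ := h
      have hle : S.card ≤ k + 1 := by
        refine hmax S fun x hx y hy hxy => ?_
        have hr : r ≤ (2 * (k + 1) + 1) * r := Nat.le_mul_of_pos_left r (by omega)
        have := hS x hx y hy hxy
        exact ⟨fun h => this.1 (hR.mono hr h), fun h => this.2 (hB.mono hr h)⟩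
      have heq : S.card = k + 1 := by omega
      obtain ⟨C, D, hcard, hcov⟩ := exists_cover_of_separated hR hB (r := r) (S := S) (by omega)
        (by rwa [heq]) (by rwa [heq])
      rw [heq] at hcard hcov
      refine ⟨C, D, hcard, fun v => (hcov v).imp ?_ ?_⟩
      · exact fun ⟨c, hc, h⟩ => ⟨c, hc, hR.mono (le_max_left _ _) h⟩
      · exact fun ⟨c, hc, h⟩ => ⟨c, hc, hB.mono (le_max_left _ _) h⟩

end IsCloseness

namespace SimpleGraph

variable {V : Type*} {G C : SimpleGraph V}

lemma isCloseness_edist (C : SimpleGraph V) :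
    IsCloseness fun (n : ℕ) x y => C.edist x y ≤ n where
  refl x := by simp
  symm h := by rwa [edist_comm]
  trans h h' := by
    push_cast
    exact SimpleGraph.edist_triangle.trans (add_le_add h h')
  mono h h' := h'.trans (by exact_mod_cast h)

/-- The ball of radius `n` around `a` in a spanning subgraph `C` of `G`, with the edges of `C`. -/
def ballSubgraph (h : C ≤ G) (a : V) (n : ℕ) : G.Subgraph where
  verts := {v | C.edist a v ≤ n}
  Adj x y := C.Adj x y ∧ C.edist a x ≤ n ∧ C.edist a y ≤ n
  adj_sub hxy := h hxy.1
  edge_vert hxy := hxy.2.1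
  symm := ⟨fun _ _ hxy => ⟨hxy.1.symm, hxy.2.2, hxy.2.1⟩⟩

lemma ballSubgraph_spanningCoe_le (h : C ≤ G) (a : V) (n : ℕ) :
    (ballSubgraph h a n).spanningCoe ≤ C :=
  fun _ _ hxy => hxy.1

lemma edist_ballSubgraph_center_le (h : C ≤ G) (a : V) (n : ℕ)
    (ha : a ∈ (ballSubgraph h a n).verts) (m : ℕ) (hm : m ≤ n)
    (v : (ballSubgraph h a n).verts) (hv : C.edist a v ≤ m) :
    (ballSubgraph h a n).coe.edist ⟨a, ha⟩ v ≤ m := by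
  induction m generalizing v with
  | zero =>
    have : a = v := by simpa using hv
    have : (⟨a, ha⟩ : (ballSubgraph h a n).verts) = v := Subtype.ext this
    simp [this]
  | succ m ih =>
    by_cases hvm : C.edist a v ≤ m
    · exact (ih (by omega) v hvm).trans (by exact_mod_cast Nat.le_succ m)
    obtain ⟨p, hp⟩ := exists_walk_of_edist_ne_top (ne_top_of_le_ne_top (by simp) hv)
    rw [← hp] at hv hvm
    have hlen : p.length ≤ m + 1 := by exact_mod_cast hv
    have hlen' : ¬ p.length ≤ m := by exact_mod_cast hvm
    have hnil : ¬ p.Nil := by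
      rw [← Walk.length_eq_zero_iff]
      omega
    have hadj := p.adj_penultimate hnil
    have hpen : C.edist a p.penultimate ≤ m := by
      refine (edist_le p.dropLast).trans ?_
      have : p.dropLast.length + 1 = p.length := Walk.length_dropLast_add_one hnil
      exact_mod_cast (by omega : p.dropLast.length ≤ m)
    have hpn : C.edist a p.penultimate ≤ n := hpen.trans (by exact_mod_cast (by omega : m ≤ n))
    have h1 := ih (by omega) ⟨p.penultimate, hpn⟩ hpen
    have h2 : (ballSubgraph h a n).coe.Adj ⟨p.penultimate, hpn⟩ v := ⟨hadj, hpn, v.2⟩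
    push_cast
    exact SimpleGraph.edist_triangle.trans (add_le_add h1 (edist_eq_one_iff_adj.2 h2).le)

lemma edist_ballSubgraph_le (h : C ≤ G) (a : V) (n : ℕ) (u v : (ballSubgraph h a n).verts) :
    (ballSubgraph h a n).coe.edist u v ≤ (2 * n : ℕ) := by
  have ha : a ∈ (ballSubgraph h a n).verts := by simp [ballSubgraph]
  have hu := edist_ballSubgraph_center_le h a n ha n le_rfl u u.2
  have hv := edist_ballSubgraph_center_le h a n ha n le_rfl v v.2
  rw [edist_comm] at hu
  rw [two_mul]
  push_cast
  exact SimpleGraph.edist_triangle.trans (add_le_add hu hv)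

end SimpleGraph

/-- There is a function `f : ℕ → ℕ` with `f 2 ≤ 60` such that every edge 2-coloured
finite graph `G` admits a covering set of at most `α(G)` monochromatic subgraphs,
each of diameter at most `f (α(G))`. -/
theorem bounded_diameter_cover_exists_f :
    ∃ f : ℕ → ℕ, f 2 ≤ 60 ∧
      ∀ (V : Type) [Fintype V] (G red blue : SimpleGraph V), red ⊔ blue = G →
        ∀ α : ℕ,
          IsGreatest {n : ℕ | ∃ s : Finset V,
            s.card = n ∧ ∀ u ∈ s, ∀ v ∈ s, u ≠ v → ¬ G.Adj u v} α →
          ∃ 𝒞 : Finset G.Subgraph,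
            𝒞.card ≤ α ∧
            (∀ H ∈ 𝒞, H.spanningCoe ≤ red ∨ H.spanningCoe ≤ blue) ∧
            (∀ H ∈ 𝒞, ∀ u v : H.verts, H.coe.edist u v ≤ (f α : ℕ∞)) ∧
            (∀ v : V, ∃ H ∈ 𝒞, v ∈ H.verts) := by
  classical
  refine ⟨fun k => 2 * IsCloseness.coverRadius k 1, by decide, ?_⟩
  intro V _ G red blue hG α hα
  have hred : red ≤ G := hG ▸ le_sup_left
  have hblue : blue ≤ G := hG ▸ le_sup_right
  obtain ⟨C, D, hcard, hcov⟩ := IsCloseness.exists_cover red.isCloseness_edist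
    blue.isCloseness_edist α 1 fun T hT => hα.2 ⟨T, rfl, fun u hu v hv huv hadj => by
      rw [← hG, SimpleGraph.sup_adj] at hadj
      rcases hadj with hadj | hadj
      · exact (hT u hu v hv huv).1 (by simp [SimpleGraph.edist_eq_one_iff_adj.2 hadj])
      · exact (hT u hu v hv huv).2 (by simp [SimpleGraph.edist_eq_one_iff_adj.2 hadj])⟩
  set n := IsCloseness.coverRadius α 1
  refine ⟨C.image (fun a => SimpleGraph.ballSubgraph hred a n) ∪
    D.image (fun a => SimpleGraph.ballSubgraph hblue a n), ?_, ?_, ?_, ?_⟩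
  · exact ((Finset.card_union_le _ _).trans
      (add_le_add Finset.card_image_le Finset.card_image_le)).trans hcard
  · intro H hH
    rcases Finset.mem_union.1 hH with hH | hH <;> obtain ⟨a, _, rfl⟩ := Finset.mem_image.1 hH
    · exact .inl (SimpleGraph.ballSubgraph_spanningCoe_le hred a n)
    · exact .inr (SimpleGraph.ballSubgraph_spanningCoe_le hblue a n)
  · intro H hH
    rcases Finset.mem_union.1 hH with hH | hH <;> obtain ⟨a, _, rfl⟩ := Finset.mem_image.1 hH
    · exact SimpleGraph.edist_ballSubgraph_le hred a n
    · exact SimpleGraph.edist_ballSubgraph_le hblue a n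
  · intro v
    rcases hcov v with ⟨c, hc, h⟩ | ⟨c, hc, h⟩
    · exact ⟨_, Finset.mem_union_left _ (Finset.mem_image_of_mem _ hc), h⟩
    · exact ⟨_, Finset.mem_union_right _ (Finset.mem_image_of_mem _ hc), h⟩
end

section
/- For every 3-partite 3-uniform hypergraph H, τ(H) ≤ 2ν(H). -/
section IndepChains

variable {V : Type*}

/-- The `ZMod 2`-chains on the simplex with vertex set `V`, in all degrees at once. -/
abbrev SimplexChain (V : Type*) := Finset V → ZMod 2

theorem simplexChain_add_self (c : SimplexChain V) : c + c = 0 := by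
  ext σ; exact CharTwo.add_self_eq_zero _

/-- `c` is a chain of independent `n`-subsets of `W`. -/
def IsIndepChain (G : SimpleGraph V) (W : Finset V) (n : ℕ) (c : SimplexChain V) : Prop :=
  ∀ σ, c σ ≠ 0 → σ ⊆ W ∧ G.IsIndepSet σ ∧ σ.card = n

variable {G : SimpleGraph V} {W : Finset V} {n k : ℕ}

theorem IsIndepChain.add {c d : SimplexChain V} (hc : IsIndepChain G W n c)
    (hd : IsIndepChain G W n d) : IsIndepChain G W n (c + d) := by
  intro σ h
  by_cases h' : c σ = 0
  · exact hd σ (by simpa [h'] using h)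
  · exact hc σ h'

theorem IsIndepChain.sum {ι : Type*} {s : Finset ι} {c : ι → SimplexChain V}
    (hc : ∀ i ∈ s, IsIndepChain G W n (c i)) : IsIndepChain G W n (∑ i ∈ s, c i) := by
  intro σ h
  rw [Finset.sum_apply] at h
  obtain ⟨i, hi, h⟩ := Finset.exists_ne_zero_of_sum_ne_zero h
  exact hc i hi σ h

theorem IsIndepChain.mono {W' : Finset V} {c : SimplexChain V} (hc : IsIndepChain G W n c)
    (h : W ⊆ W') : IsIndepChain G W' n c :=
  fun σ hσ => ⟨(hc σ hσ).1.trans h, (hc σ hσ).2⟩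

variable [DecidableEq V]

/-- Removal of the vertex `v` from every face containing it; other faces are killed. -/
def contract (v : V) : SimplexChain V →ₗ[ZMod 2] SimplexChain V where
  toFun c σ := if v ∈ σ then 0 else c (insert v σ)
  map_add' c d := by ext σ; by_cases h : v ∈ σ <;> simp [h]
  map_smul' r c := by ext σ; by_cases h : v ∈ σ <;> simp [h]

/-- Addition of the vertex `v` to every face not containing it; other faces are killed. -/
def cone (v : V) : SimplexChain V →ₗ[ZMod 2] SimplexChain V where
  toFun c σ := if v ∈ σ then c (σ.erase v) else 0
  map_add' c d := by ext σ; by_cases h : v ∈ σ <;> simp [h]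
  map_smul' r c := by ext σ; by_cases h : v ∈ σ <;> simp [h]

theorem contract_apply (v : V) (c : SimplexChain V) (σ : Finset V) :
    contract v c σ = if v ∈ σ then 0 else c (insert v σ) := rfl

theorem cone_apply (v : V) (c : SimplexChain V) (σ : Finset V) :
    cone v c σ = if v ∈ σ then c (σ.erase v) else 0 := rfl

theorem contract_contract_self (v : V) (c : SimplexChain V) : contract v (contract v c) = 0 := by
  ext σ; simp [contract_apply]

theorem contract_comm (v w : V) (c : SimplexChain V) :
    contract v (contract w c) = contract w (contract v c) := by
  rcases eq_or_ne v w with rfl | h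
  · rfl
  ext σ
  simp only [contract_apply, Finset.mem_insert, h, h.symm, false_or, Finset.insert_comm w v]
  split_ifs <;> rfl

theorem contract_cone (v w : V) (c : SimplexChain V) :
    contract w (cone v c) = (if w = v then c else 0) + cone v (contract w c) := by
  ext σ
  rcases eq_or_ne w v with rfl | h
  · by_cases hw : w ∈ σ <;> simp [contract_apply, cone_apply, hw, CharTwo.add_self_eq_zero]
  · by_cases hw : w ∈ σ <;> by_cases hv : v ∈ σ <;>
      simp [contract_apply, cone_apply, hw, hv, h, h.symm, Finset.erase_insert_of_ne]

/-- The sum of `contract v` over `v ∈ S`. -/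
def partialBoundary (S : Finset V) : SimplexChain V →ₗ[ZMod 2] SimplexChain V :=
  ∑ v ∈ S, contract v

theorem partialBoundary_apply (S : Finset V) (c : SimplexChain V) :
    partialBoundary S c = ∑ v ∈ S, contract v c := by
  simp [partialBoundary]

theorem contract_partialBoundary (v : V) (S : Finset V) (c : SimplexChain V) :
    contract v (partialBoundary S c) = partialBoundary S (contract v c) := by
  simp [partialBoundary_apply, contract_comm v]

theorem partialBoundary_comm (S T : Finset V) (c : SimplexChain V) :
    partialBoundary S (partialBoundary T c) = partialBoundary T (partialBoundary S c) := by
  simp only [partialBoundary_apply S, contract_partialBoundary, map_sum]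

theorem partialBoundary_self (S : Finset V) (c : SimplexChain V) :
    partialBoundary S (partialBoundary S c) = 0 := by
  induction S using Finset.induction_on generalizing c with
  | empty => simp [partialBoundary]
  | insert v S hv ih =>
    have key (d : SimplexChain V) :
        partialBoundary (insert v S) d = contract v d + partialBoundary S d := by
      simp [partialBoundary_apply, Finset.sum_insert hv]
    simp only [key, map_add, ih, contract_contract_self, contract_partialBoundary]
    simp [simplexChain_add_self]

theorem IsIndepChain.cone {W' : Finset V} {c : SimplexChain V} (hc : IsIndepChain G W' n c) {v : V}
    (hW : W' ⊆ W) (hv : v ∈ W) (hadj : ∀ w ∈ W', ¬ G.Adj v w) :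
    IsIndepChain G W (n + 1) (cone v c) := by
  intro σ hσ
  rw [cone_apply] at hσ
  split_ifs at hσ with hvσ
  · obtain ⟨h1, h2, h3⟩ := hc _ hσ
    rw [← Finset.insert_erase hvσ]
    refine ⟨Finset.insert_subset hv (h1.trans hW), ?_, ?_⟩
    · intro a ha b hb hab
      rw [Finset.mem_coe, Finset.mem_insert] at ha hb
      rcases ha with rfl | ha <;> rcases hb with rfl | hb
      · exact absurd rfl hab
      · exact hadj b (h1 hb)
      · exact fun h => hadj a (h1 ha) h.symm
      · exact h2 (Finset.mem_coe.2 ha) (Finset.mem_coe.2 hb) hab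
    · rw [Finset.card_insert_of_notMem (by simp), h3]
  · exact absurd rfl hσ

variable [Fintype V]

theorem partialBoundary_univ_cone (v : V) (c : SimplexChain V) :
    partialBoundary .univ (cone v c) = c + cone v (partialBoundary .univ c) := by
  simp [partialBoundary_apply, contract_cone, Finset.sum_add_distrib]

/-- The independence complex of `G` on `W` has trivial reduced homology mod 2 for faces
with fewer than `k` vertices. -/
def IsIndepAcyclic (G : SimpleGraph V) (W : Finset V) (k : ℕ) : Prop :=
  ∀ j < k, ∀ z, IsIndepChain G W j z → partialBoundary .univ z = 0 →
    ∃ w, IsIndepChain G W (j + 1) w ∧ partialBoundary .univ w = z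

theorem isIndepAcyclic_of_isolated {v : V} (hv : v ∈ W) (hadj : ∀ w ∈ W, ¬ G.Adj v w) (k : ℕ) :
    IsIndepAcyclic G W k := by
  intro j _ z hz hz0
  exact ⟨cone v z, hz.cone subset_rfl hv hadj, by simp [partialBoundary_univ_cone, hz0]⟩

open scoped Classical in
/-- Meshulam's deletion/explosion recursion. -/
theorem isIndepAcyclic_of_deleteEdges {x y : V} (hx : x ∈ W) (hy : y ∈ W)
    (hxy : G.Adj x y)
    (hdel : IsIndepAcyclic (G.deleteEdges {s(x, y)}) W (k + 1))
    (hexp : IsIndepAcyclic G (W.filter fun v => ¬ G.Adj x v ∧ ¬ G.Adj y v) k) :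
    IsIndepAcyclic G W (k + 1) := by
  intro j hj z hz hz0
  have hne := hxy.ne
  obtain ⟨w, hw, rfl⟩ := hdel j hj z
    (fun σ hσ => ⟨(hz σ hσ).1, fun a ha b hb hab h => (hz σ hσ).2.1 ha hb hab
      (SimpleGraph.deleteEdges_le _ h), (hz σ hσ).2.2⟩) hz0
  have hindep {σ : Finset V} (hσ : (G.deleteEdges {s(x, y)}).IsIndepSet σ)
      (h : ¬ (x ∈ σ ∧ y ∈ σ)) : G.IsIndepSet σ := by
    intro a ha b hb hab hadj
    refine hσ ha hb hab ?_
    rw [SimpleGraph.deleteEdges_adj]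
    refine ⟨hadj, fun he => h ?_⟩
    simp only [Set.mem_singleton_iff, Sym2.eq_iff] at he
    rcases he with ⟨rfl, rfl⟩ | ⟨rfl, rfl⟩
    exacts [⟨ha, hb⟩, ⟨hb, ha⟩]
  set W' := W.filter fun v => ¬ G.Adj x v ∧ ¬ G.Adj y v
  set u := contract x (contract y w) with hu
  have hu_apply (σ) : u σ = if x ∈ σ ∨ y ∈ σ then 0 else w (insert x (insert y σ)) := by
    simp only [hu, contract_apply, Finset.mem_insert, hne.symm, false_or]
    by_cases h1 : x ∈ σ <;> by_cases h2 : y ∈ σ <;> simp [h1, h2, Finset.insert_comm]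
  obtain ⟨t, ht, htu⟩ : ∃ t, IsIndepChain G W' j t ∧ partialBoundary .univ t = u := by
    have hsupp (σ) (hσ : u σ ≠ 0) : σ ⊆ W' ∧ G.IsIndepSet σ ∧ σ.card + 1 = j := by
      rw [hu_apply] at hσ
      split_ifs at hσ with h
      · exact absurd rfl hσ
      push Not at h
      obtain ⟨h1, h2, h3⟩ := hw _ hσ
      have hnadj {v p q : V} (hpq : s(p, q) = s(x, y)) (hv : v ∈ σ) : ¬ G.Adj p v := by
        intro hadj
        have hp : p = x ∨ p = y := by
          rcases Sym2.eq_iff.1 hpq with h | h <;> simp [h]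
        have hvx : v ≠ x := fun h' => h.1 (h' ▸ hv)
        have hvy : v ≠ y := fun h' => h.2 (h' ▸ hv)
        refine h2 (x := p) (y := v) (by rcases hp with rfl | rfl <;> simp) (by simp [hv])
          hadj.ne ?_
        rw [SimpleGraph.deleteEdges_adj]
        exact ⟨hadj, by simp [hvx, hvy]⟩
      refine ⟨fun v hv => ?_, hindep (fun a ha b hb => h2 ?_ ?_) (fun h' => h.1 h'.1), ?_⟩
      · exact Finset.mem_filter.2 ⟨h1 (by simp [hv]), hnadj rfl hv, hnadj Sym2.eq_swap hv⟩
      · simp_all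
      · simp_all
      · rw [Finset.card_insert_of_notMem (by simp [hne, h.1]),
          Finset.card_insert_of_notMem h.2] at h3
        omega
    rcases j with _ | j
    · refine ⟨0, fun σ h => absurd rfl h, ?_⟩
      ext σ
      by_contra h
      have := (hsupp σ (fun h' => h (by simp [h']))).2.2
      omega
    · refine hexp j (by omega) u (fun σ hσ => ?_) ?_
      · exact ⟨(hsupp σ hσ).1, (hsupp σ hσ).2.1, by have := (hsupp σ hσ).2.2; omega⟩
      · rw [hu, ← contract_partialBoundary, ← contract_partialBoundary]
        ext σ
        by_contra h
        simp only [contract_apply, Pi.zero_apply] at h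
        split_ifs at h with h1 h2
        · exact h rfl
        · exact h rfl
        · exact (hz _ h).2.1 (x := x) (y := y) (by simp) (by simp) hne hxy
  have hdec : w + partialBoundary .univ (cone x (cone y t))
      = (w + cone x (cone y u)) + (cone x t + cone y t) := by
    simp only [partialBoundary_univ_cone, map_add, htu]
    abel
  refine ⟨w + partialBoundary .univ (cone x (cone y t)), ?_, ?_⟩
  · rw [hdec]
    refine .add ?_ (.add ?_ ?_)
    · intro σ hσ
      have : (cone x (cone y u)) σ = if x ∈ σ ∧ y ∈ σ then w σ else 0 := by
        simp only [cone_apply, Finset.mem_erase, hu_apply]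
        by_cases h1 : x ∈ σ <;> by_cases h2 : y ∈ σ <;> simp [h1, h2, hne.symm]
      rw [Pi.add_apply, this] at hσ
      split_ifs at hσ with h
      · exact absurd (CharTwo.add_self_eq_zero _) hσ
      · obtain ⟨h1, h2, h3⟩ := hw σ (by simpa using hσ)
        exact ⟨h1, hindep h2 h, h3⟩
    · exact ht.cone (Finset.filter_subset _ _) hx fun v hv => (Finset.mem_filter.1 hv).2.1
    · exact ht.cone (Finset.filter_subset _ _) hy fun v hv => (Finset.mem_filter.1 hv).2.2
  · rw [map_add, partialBoundary_self, add_zero]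

open scoped Classical in
/-- If the neighbourhood of every vertex has weight at most two in an independent set of total
weight at least `2 * k - 1`, then the independence complex is acyclic below `k`. -/
theorem isIndepAcyclic_of_weight (wt : V → ℕ) (M : Finset V) (hMW : M ⊆ W)
    (hM : G.IsIndepSet M) (hwt : ∀ v ∈ W, ∑ m ∈ M with G.Adj v m, wt m ≤ 2)
    (hk : 2 * k ≤ ∑ m ∈ M, wt m + 1) : IsIndepAcyclic G W k := by
  induction k generalizing W M G with
  | zero => intro j hj; omega
  | succ k ih =>
    induction G using WellFoundedLT.induction with
    | _ G ihG =>
    obtain ⟨f, hf⟩ : M.Nonempty := by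
      by_contra h
      rw [Finset.not_nonempty_iff_eq_empty.1 h] at hk
      rw [Finset.sum_empty] at hk
      omega
    by_cases hiso : ∀ w ∈ W, ¬ G.Adj f w
    · exact isIndepAcyclic_of_isolated (hMW hf) hiso _
    push Not at hiso
    obtain ⟨e, he, hfe⟩ := hiso
    refine isIndepAcyclic_of_deleteEdges (hMW hf) he hfe ?_ ?_
    · have hle := G.deleteEdges_le {s(f, e)}
      refine ihG _ (lt_of_le_of_ne hle fun h => ?_) (fun a ha b hb hab h => hM ha hb hab (hle h)) ?_
      · rw [← h] at hfe
        simp at hfe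
      · intro v hv
        refine le_trans (Finset.sum_le_sum_of_subset ?_) (hwt v hv)
        intro a ha
        simp only [Finset.mem_filter] at ha ⊢
        exact ⟨ha.1, hle ha.2⟩
    · refine ih (M.filter fun m => ¬ G.Adj e m) ?_ ?_ ?_ ?_
      · intro m hm
        rw [Finset.mem_filter] at hm ⊢
        exact ⟨hMW hm.1, fun h => hM hf hm.1 h.ne h, hm.2⟩
      · exact hM.mono (Finset.coe_subset.2 (Finset.filter_subset _ _))
      · intro v hv
        refine le_trans (Finset.sum_le_sum_of_subset ?_) (hwt v (Finset.mem_filter.1 hv).1)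
        exact Finset.filter_subset_filter _ (Finset.filter_subset _ _)
      · have h1 := Finset.sum_filter_add_sum_filter_not M (fun m => G.Adj e m) wt
        have h2 := hwt e he
        omega

section Rainbow

variable {A : Type*} [DecidableEq A] (col : V → A)

/-- Removal of one vertex of colour `a`, summed over all such vertices. -/
def colorBoundary (a : A) : SimplexChain V →ₗ[ZMod 2] SimplexChain V :=
  partialBoundary (Finset.univ.filter fun v => col v = a)

theorem partialBoundary_univ_eq_sum [Fintype A] (c : SimplexChain V) :
    partialBoundary .univ c = ∑ a, colorBoundary col a c := by
  simp only [colorBoundary, partialBoundary_apply]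
  exact (Finset.sum_fiberwise _ _ _).symm

theorem colorBoundary_comm (a b : A) (c : SimplexChain V) :
    colorBoundary col a (colorBoundary col b c) = colorBoundary col b (colorBoundary col a c) :=
  partialBoundary_comm _ _ _

theorem colorBoundary_eq_zero {I : Finset A} {a : A} (ha : a ∉ I) {c : SimplexChain V}
    (hc : IsIndepChain G (W.filter fun v => col v ∈ I) n c) : colorBoundary col a c = 0 := by
  rw [colorBoundary, partialBoundary_apply]
  refine Finset.sum_eq_zero fun v hv => ?_
  ext σ
  by_contra h
  simp only [contract_apply, Pi.zero_apply] at h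
  split_ifs at h with h1
  · exact h rfl
  · have := (Finset.mem_filter.1 ((hc _ h).1 (Finset.mem_insert_self v σ))).2
    rw [(Finset.mem_filter.1 hv).2] at this
    exact ha this

/-- Successive removal of one vertex of each colour in the list. -/
def colorBoundaries (L : List A) (c : SimplexChain V) : SimplexChain V :=
  L.foldl (fun c a => colorBoundary col a c) c

theorem colorBoundaries_cons (a : A) (L : List A) (c : SimplexChain V) :
    colorBoundaries col (a :: L) c = colorBoundaries col L (colorBoundary col a c) := rfl

theorem colorBoundaries_add (L : List A) (c d : SimplexChain V) :
    colorBoundaries col L (c + d) = colorBoundaries col L c + colorBoundaries col L d := by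
  induction L generalizing c d with
  | nil => rfl
  | cons a L ih => simp only [colorBoundaries_cons, map_add, ih]

theorem colorBoundaries_zero (L : List A) : colorBoundaries col L (0 : SimplexChain V) = 0 := by
  induction L with
  | nil => rfl
  | cons a L ih => simpa only [colorBoundaries_cons, map_zero]

theorem colorBoundaries_sum {ι : Type*} (L : List A) (s : Finset ι) (c : ι → SimplexChain V) :
    colorBoundaries col L (∑ i ∈ s, c i) = ∑ i ∈ s, colorBoundaries col L (c i) :=
  map_sum (⟨⟨colorBoundaries col L, colorBoundaries_zero col L⟩, colorBoundaries_add col L⟩ :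
    SimplexChain V →+ SimplexChain V) c s

theorem colorBoundaries_eq_zero {L : List A} {a : A} (ha : a ∈ L) {c : SimplexChain V}
    (hc : colorBoundary col a c = 0) : colorBoundaries col L c = 0 := by
  induction L generalizing c with
  | nil => simp at ha
  | cons b L ih =>
    rw [colorBoundaries_cons]
    rcases List.mem_cons.1 ha with rfl | ha
    · rw [hc, colorBoundaries_zero]
    · refine ih ha ?_
      rw [colorBoundary_comm, hc, map_zero]

theorem exists_of_colorBoundaries_ne_zero {L : List A} {c : SimplexChain V} {τ : Finset V}
    (h : colorBoundaries col L c τ ≠ 0) : ∃ σ, c σ ≠ 0 ∧ ∀ a ∈ L, ∃ v ∈ σ, col v = a := by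
  induction L generalizing c with
  | nil => exact ⟨τ, h, by simp⟩
  | cons b L ih =>
    obtain ⟨σ, hσ, hL⟩ := ih (c := colorBoundary col b c) h
    rw [colorBoundary, partialBoundary_apply, Finset.sum_apply] at hσ
    obtain ⟨v, hv, hvσ⟩ := Finset.exists_ne_zero_of_sum_ne_zero hσ
    rw [contract_apply] at hvσ
    split_ifs at hvσ with hmem
    · exact absurd rfl hvσ
    · refine ⟨_, hvσ, fun a ha => ?_⟩
      rcases List.mem_cons.1 ha with rfl | ha
      · exact ⟨v, by simp, (Finset.mem_filter.1 hv).2⟩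
      · obtain ⟨w, hw, hwa⟩ := hL a ha
        exact ⟨w, by simp [hw], hwa⟩

/-- A chain map from the simplex on the colours, the image of each face `I` being supported on
independent sets with colours in `I`. -/
theorem exists_chainMap [Fintype A]
    (h : ∀ I : Finset A, IsIndepAcyclic G (W.filter fun v => col v ∈ I) I.card) :
    ∃ c : Finset A → SimplexChain V, c ∅ ∅ = 1 ∧ ∀ I,
      IsIndepChain G (W.filter fun v => col v ∈ I) I.card (c I) ∧
      partialBoundary .univ (c I) = ∑ a ∈ I, c (I.erase a) := by
  suffices H : ∀ m, ∃ c : Finset A → SimplexChain V, c ∅ ∅ = 1 ∧ ∀ I, I.card ≤ m →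
      IsIndepChain G (W.filter fun v => col v ∈ I) I.card (c I) ∧
      partialBoundary .univ (c I) = ∑ a ∈ I, c (I.erase a) by
    obtain ⟨c, hc0, hc⟩ := H (Fintype.card A)
    exact ⟨c, hc0, fun I => hc I I.card_le_univ⟩
  intro m
  induction m with
  | zero =>
    refine ⟨fun _ σ => if σ = ∅ then 1 else 0, by simp, fun I hI => ?_⟩
    obtain rfl := Finset.card_eq_zero.1 (Nat.le_zero.1 hI)
    refine ⟨fun σ hσ => ?_, ?_⟩
    · have : σ = ∅ := by by_contra h; simp [h] at hσ
      simp [this]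
    · rw [partialBoundary_apply, Finset.sum_empty]
      refine Finset.sum_eq_zero fun v _ => ?_
      ext σ
      simp [contract_apply]
  | succ m ih =>
    obtain ⟨c, hc0, hc⟩ := ih
    have hfill (I : Finset A) (hI : I.card = m + 1) : ∃ w,
        IsIndepChain G (W.filter fun v => col v ∈ I) (m + 1) w ∧
        partialBoundary .univ w = ∑ a ∈ I, c (I.erase a) := by
      have hcard {a : A} (ha : a ∈ I) : (I.erase a).card = m := by
        rw [Finset.card_erase_of_mem ha, hI, Nat.add_sub_cancel]
      refine h I m (by omega) _ (.sum fun a ha => ?_) ?_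
      · have := (hc _ (hcard ha).le).1
        rw [hcard ha] at this
        refine this.mono (Finset.monotone_filter_right _ fun v _ hv => Finset.mem_of_mem_erase hv)
      · rw [map_sum, Finset.sum_congr rfl fun a ha => (hc _ (hcard ha).le).2, Finset.sum_sigma']
        refine Finset.sum_involution (fun p _ => ⟨p.2, p.1⟩) ?_ ?_ ?_ ?_
        · rintro ⟨a, b⟩ _
          simp only [Finset.erase_right_comm (a := b)]
          exact simplexChain_add_self _
        · rintro ⟨a, b⟩ hab _ heq
          simp_all
        · rintro ⟨a, b⟩ hab
          simp_all [eq_comm]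
        · rintro ⟨a, b⟩ _
          rfl
    choose! w hw using hfill
    refine ⟨fun I => if I.card = m + 1 then w I else c I, by simp [hc0], fun I hI => ?_⟩
    have hrec : ∑ a ∈ I, (if (I.erase a).card = m + 1 then w (I.erase a) else c (I.erase a)) =
        ∑ a ∈ I, c (I.erase a) := by
      refine Finset.sum_congr rfl fun a ha => if_neg ?_
      have := Finset.card_erase_lt_of_mem ha
      omega
    dsimp only
    rw [hrec]
    split_ifs with hcard
    · rw [hcard]
      exact hw I hcard
    · exact hc I (by omega)

theorem exists_rainbow_isIndepSet [Fintype A]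
    (h : ∀ I : Finset A, IsIndepAcyclic G (W.filter fun v => col v ∈ I) I.card) :
    ∃ σ ⊆ W, G.IsIndepSet σ ∧ Set.InjOn col σ ∧ σ.card = Fintype.card A := by
  obtain ⟨c, hc0, hc⟩ := exists_chainMap col h
  have key (L : List A) (hL : L.Nodup) : colorBoundaries col L (c L.toFinset) ∅ = 1 := by
    induction L with
    | nil => exact hc0
    | cons a L ih =>
      obtain ⟨haL, hL⟩ := List.nodup_cons.1 hL
      rw [← ih hL, colorBoundaries_cons]
      set I := (a :: L).toFinset with hI
      have herase : I.erase a = L.toFinset := by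
        rw [hI, List.toFinset_cons, Finset.erase_insert (by simpa using haL)]
      have h1 : colorBoundaries col L (partialBoundary .univ (c I)) =
          colorBoundaries col L (colorBoundary col a (c I)) := by
        rw [partialBoundary_univ_eq_sum col, colorBoundaries_sum]
        refine Finset.sum_eq_single a (fun b _ hb => ?_) (by simp)
        by_cases hbL : b ∈ L
        · exact colorBoundaries_eq_zero col hbL (partialBoundary_self _ _)
        · rw [colorBoundary_eq_zero col (I := I) (by simp [hI, hb, hbL]) (hc I).1,
            colorBoundaries_zero]
      have h2 : colorBoundaries col L (∑ b ∈ I, c (I.erase b)) =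
          colorBoundaries col L (c (I.erase a)) := by
        rw [colorBoundaries_sum]
        refine Finset.sum_eq_single a (fun b hbI hb => ?_) (by simp [hI])
        have hbL : b ∈ L := by simpa [hI, hb] using hbI
        exact colorBoundaries_eq_zero col hbL
          (colorBoundary_eq_zero col (Finset.notMem_erase b I) (hc _).1)
      rw [← h1, (hc I).2, h2, herase]
  obtain ⟨σ, hσ, hcol⟩ := exists_of_colorBoundaries_ne_zero col (L := Finset.univ.toList)
    (c := c Finset.univ) (τ := ∅)
    (by have := key _ (Finset.nodup_toList Finset.univ)
        rw [Finset.toList_toFinset] at this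
        simp [this])
  obtain ⟨h1, h2, h3⟩ := (hc _).1 σ hσ
  refine ⟨σ, h1.trans (Finset.filter_subset _ _), h2, Finset.injOn_of_surjOn_of_card_le
    (t := Finset.univ) col (fun _ _ => Finset.mem_coe.2 (Finset.mem_univ _)) ?_ h3.le, h3⟩
  intro a _
  obtain ⟨v, hv, hva⟩ := hcol a (by simp)
  exact ⟨v, hv, hva⟩

end Rainbow

end IndepChains

section Matching

variable {A B C X : Type*} [DecidableEq X]

private theorem exists_matching_cover_of_shared [DecidableEq B] [DecidableEq C]
    (p : X → B) (q : X → C) (F : Finset X)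
    (ih : ∀ F' ⊂ F, ∃ N ⊆ F', Set.InjOn p N ∧ Set.InjOn q N ∧ ∃ (S : Finset B) (T : Finset C),
      (∀ e ∈ F', p e ∈ S ∨ q e ∈ T) ∧ S.card + T.card ≤ N.card)
    {e f : X} (he : e ∈ F) (hf : f ∈ F) (hef : e ≠ f) (hpef : p e = p f) :
    ∃ N ⊆ F, Set.InjOn p N ∧ Set.InjOn q N ∧ ∃ (S : Finset B) (T : Finset C),
      (∀ e ∈ F, p e ∈ S ∨ q e ∈ T) ∧ S.card + T.card ≤ N.card := by
  obtain ⟨N₁, hN₁, hp₁, hq₁, S₁, T₁, hc₁, hle₁⟩ := ih _ (Finset.erase_ssubset he)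
  obtain ⟨N₂, hN₂, hp₂, hq₂, S₂, T₂, hc₂, hle₂⟩ := ih _ (Finset.erase_ssubset hf)
  replace hN₁ := hN₁.trans (Finset.erase_subset _ _)
  replace hN₂ := hN₂.trans (Finset.erase_subset _ _)
  replace hc₁ (g) (hg : g ∈ F) (hge : g ≠ e) := hc₁ g (Finset.mem_erase.2 ⟨hge, hg⟩)
  replace hc₂ (g) (hg : g ∈ F) (hgf : g ≠ f) := hc₂ g (Finset.mem_erase.2 ⟨hgf, hg⟩)
  by_cases h₁ : p e ∈ S₁ ∨ q e ∈ T₁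
  · exact ⟨N₁, hN₁, hp₁, hq₁, S₁, T₁, fun g hg => by grind, hle₁⟩
  by_cases h₂ : p f ∈ S₂ ∨ q f ∈ T₂
  · exact ⟨N₂, hN₂, hp₂, hq₂, S₂, T₂, fun g hg => by grind, hle₂⟩
  have hi₁ := Finset.card_insert_le (p e) S₁
  have hi₂ := Finset.card_insert_le (p e) S₂
  rcases lt_trichotomy N₁.card N₂.card with hlt | heq | hlt
  · exact ⟨N₂, hN₂, hp₂, hq₂, insert (p e) S₁, T₁, fun g hg => by grind, by omega⟩
  · have hS := Finset.card_union_add_card_inter S₁ S₂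
    have hT := Finset.card_union_add_card_inter T₁ T₂
    have hi := Finset.card_insert_le (p e) (S₁ ∪ S₂)
    by_cases hle : (S₁ ∩ S₂).card + (T₁ ∪ T₂).card ≤ N₁.card
    · exact ⟨N₁, hN₁, hp₁, hq₁, S₁ ∩ S₂, T₁ ∪ T₂, fun g hg => by grind, hle⟩
    · exact ⟨N₁, hN₁, hp₁, hq₁, insert (p e) (S₁ ∪ S₂), T₁ ∩ T₂, fun g hg => by grind, by omega⟩
  · exact ⟨N₁, hN₁, hp₁, hq₁, insert (p e) S₂, T₂, fun g hg => by grind, by omega⟩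

/-- König's theorem for the bipartite multigraph in which `e ∈ F` joins `p e` and `q e`. -/
theorem exists_matching_cover [DecidableEq B] [DecidableEq C]
    (p : X → B) (q : X → C) (F : Finset X) :
    ∃ N ⊆ F, Set.InjOn p N ∧ Set.InjOn q N ∧ ∃ (S : Finset B) (T : Finset C),
      (∀ e ∈ F, p e ∈ S ∨ q e ∈ T) ∧ S.card + T.card ≤ N.card := by
  induction F using Finset.strongInduction with
  | H F ih =>
  by_cases hp : Set.InjOn p F
  · by_cases hq : Set.InjOn q F
    · exact ⟨F, subset_rfl, hp, hq, F.image p, ∅, fun e he => .inl (Finset.mem_image_of_mem p he),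
        by simpa using Finset.card_image_le⟩
    · simp only [Set.InjOn] at hq
      push Not at hq
      obtain ⟨e, he, f, hf, hq, hef⟩ := hq
      obtain ⟨N, hN, h1, h2, S, T, h3, h4⟩ := exists_matching_cover_of_shared q p F
        (fun F' hF' => by
          obtain ⟨N, hN, h1, h2, S, T, h3, h4⟩ := ih F' hF'
          exact ⟨N, hN, h2, h1, T, S, fun e he => (h3 e he).symm, by omega⟩) he hf hef hq
      exact ⟨N, hN, h2, h1, T, S, fun e he => (h3 e he).symm, by omega⟩
  · simp only [Set.InjOn] at hp
    push Not at hp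
    obtain ⟨e, he, f, hf, hp, hef⟩ := hp
    exact exists_matching_cover_of_shared p q F ih he hf hef hp

/-- The conflict graph on the disjoint union of `X` and `A × D`: elements of `X` conflict if they
agree under `p` or `q`, and pairs conflict if they have the same second entry. -/
def conflictGraph (A D : Type*) (p : X → B) (q : X → C) : SimpleGraph (X ⊕ A × D) where
  Adj
    | .inl e, .inl f => e ≠ f ∧ (p e = p f ∨ q e = q f)
    | .inr s, .inr t => s ≠ t ∧ s.2 = t.2
    | _, _ => False
  symm := ⟨by rintro (e | s) (f | t) h <;> grind⟩
  loopless := ⟨by rintro (e | s) h <;> exact h.1 rfl⟩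

/-- The deficiency version of Hall's theorem for families of bipartite graphs. -/
theorem exists_rainbow_matching [Fintype X] [Fintype A] [DecidableEq A] (col : X → A) (p : X → B)
    (q : X → C) (E : Finset X) (d : ℕ)
    (h : ∀ I : Finset A, ∃ N ⊆ E.filter fun e => col e ∈ I, Set.InjOn p N ∧ Set.InjOn q N ∧
      2 * I.card ≤ N.card + 2 * d + 1) :
    ∃ M ⊆ E, Set.InjOn col M ∧ Set.InjOn p M ∧ Set.InjOn q M ∧ Fintype.card A ≤ M.card + d := by
  classical
  set G := conflictGraph A (Fin d) p q
  have hacyc (I : Finset A) : IsIndepAcyclic G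
      ((E.disjSum Finset.univ).filter fun v => Sum.elim col Prod.fst v ∈ I) I.card := by
    rcases I.eq_empty_or_nonempty with rfl | ⟨a, ha⟩
    · intro j hj
      simp at hj
    obtain ⟨N, hN, hp, hq, hcard⟩ := h I
    refine isIndepAcyclic_of_weight (Sum.elim (fun _ => 1) (fun _ => 2))
      (N.disjSum (Finset.univ.map ⟨fun i : Fin d => (a, i), fun i j h => (Prod.ext_iff.1 h).2⟩))
      ?_ ?_ ?_ ?_
    · rintro (e | s) hv
      · have := hN (Finset.inl_mem_disjSum.1 hv)
        simpa using this
      · obtain ⟨i, -, rfl⟩ := Finset.mem_map.1 (Finset.inr_mem_disjSum.1 hv)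
        exact Finset.mem_filter.2 ⟨by simp, ha⟩
    · rintro (e | s) hv (f | t) hw hne hadj
      · rw [Finset.mem_coe, Finset.inl_mem_disjSum] at hv hw
        rcases hadj.2 with h | h
        · exact hadj.1 (hp hv hw h)
        · exact hadj.1 (hq hv hw h)
      · exact hadj
      · exact hadj
      · rw [Finset.mem_coe, Finset.inr_mem_disjSum] at hv hw
        obtain ⟨i, -, rfl⟩ := Finset.mem_map.1 hv
        obtain ⟨j, -, rfl⟩ := Finset.mem_map.1 hw
        exact hadj.1 (Prod.ext rfl hadj.2)
    · intro v _
      rw [Finset.sum_filter, Finset.sum_disjSum, Finset.sum_map]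
      rcases v with e | s
      · have h1 : ∀ f, ¬ G.Adj (Sum.inl e) (Sum.inr f) := fun f h => h
        simp only [h1, Sum.elim_inl, if_false,
          Finset.sum_const_zero, add_zero, ← Finset.card_filter]
        have hpN : (N.filter fun f => p f = p e).card ≤ 1 := by
          rw [Finset.card_le_one]
          intro x hx y hy
          rw [Finset.mem_filter] at hx hy
          exact hp hx.1 hy.1 (hx.2.trans hy.2.symm)
        have hqN : (N.filter fun f => q f = q e).card ≤ 1 := by
          rw [Finset.card_le_one]
          intro x hx y hy
          rw [Finset.mem_filter] at hx hy
          exact hq hx.1 hy.1 (hx.2.trans hy.2.symm)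
        refine le_trans (Finset.card_le_card fun f hf => ?_)
          ((Finset.card_union_le _ _).trans (add_le_add hpN hqN))
        obtain ⟨hfN, hadj⟩ := Finset.mem_filter.1 hf
        rw [Finset.mem_union, Finset.mem_filter, Finset.mem_filter]
        exact hadj.2.imp (fun h => ⟨hfN, h.symm⟩) (fun h => ⟨hfN, h.symm⟩)
      · have h1 : ∀ f, ¬ G.Adj (Sum.inr s) (Sum.inl f) := fun f h => h
        simp only [h1, Sum.elim_inr, if_false,
          Finset.sum_const_zero, zero_add]
        calc _ ≤ ∑ i : Fin d, if s.2 = i then 2 else 0 := by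
              refine Finset.sum_le_sum fun i _ => ?_
              split_ifs with h2 h3
              · rfl
              · exact absurd h2.2 h3
              · omega
              · rfl
          _ ≤ 2 := by simp
    · rw [Finset.sum_disjSum, Finset.sum_map]
      simp
      omega
  obtain ⟨σ, hσ, hind, hcol, hcard⟩ := exists_rainbow_isIndepSet _ hacyc
  have hind' {e f : X} (he : .inl e ∈ σ) (hf : .inl f ∈ σ) (h : p e = p f ∨ q e = q f) :
      e = f := by
    by_contra hne
    exact hind he hf (by simpa using hne) ⟨hne, h⟩
  refine ⟨σ.toLeft, fun e he => ?_, fun e he f hf hef => ?_, fun e he f hf hef => ?_,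
    fun e he f hf hef => ?_, ?_⟩
  · exact Finset.inl_mem_disjSum.1 (hσ (Finset.mem_toLeft.1 he))
  · exact Sum.inl_injective (hcol (Finset.mem_toLeft.1 he) (Finset.mem_toLeft.1 hf) hef)
  · exact hind' (Finset.mem_toLeft.1 he) (Finset.mem_toLeft.1 hf) (.inl hef)
  · exact hind' (Finset.mem_toLeft.1 he) (Finset.mem_toLeft.1 hf) (.inr hef)
  · have hright : σ.toRight.card ≤ d := by
      have := Finset.card_le_card_of_injOn (s := σ.toRight) (t := Finset.univ) Prod.snd
        (fun _ _ => Finset.mem_coe.2 (Finset.mem_univ _)) (fun s hs t ht hst => by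
          by_contra hne
          exact hind (Finset.mem_toRight.1 hs) (Finset.mem_toRight.1 ht) (by simpa using hne)
            ⟨hne, hst⟩)
      simpa using this
    have := σ.card_toLeft_add_card_toRight
    omega

end Matching

/-- Aharoni's theorem (Ryser's conjecture for `r = 3`): every finite 3-partite
3-uniform hypergraph (edges given as triples, one vertex from each part) satisfies
`τ(H) ≤ 2ν(H)`: there exist a vertex cover `T` and a matching `M` with
`|T| ≤ 2|M|`. -/
theorem aharoni_ryser_three {A B C : Type*} [Fintype A] [Fintype B] [Fintype C]
    [DecidableEq A] [DecidableEq B] [DecidableEq C]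
    (E : Finset (A × B × C)) :
    ∃ (T : Finset (A ⊕ B ⊕ C)) (M : Finset (A × B × C)),
      M ⊆ E ∧
      (∀ e ∈ M, ∀ f ∈ M, e ≠ f →
        e.1 ≠ f.1 ∧ e.2.1 ≠ f.2.1 ∧ e.2.2 ≠ f.2.2) ∧
      (∀ e ∈ E, Sum.inl e.1 ∈ T ∨ Sum.inr (Sum.inl e.2.1) ∈ T ∨
        Sum.inr (Sum.inr e.2.2) ∈ T) ∧
      T.card ≤ 2 * M.card := by
  classical
  obtain ⟨M, hM, hmax⟩ := Finset.exists_max_image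
    (E.powerset.filter fun M : Finset (A × B × C) => Set.InjOn (fun e : A × B × C => e.1) M ∧
      Set.InjOn (fun e : A × B × C => e.2.1) M ∧
      Set.InjOn (fun e : A × B × C => e.2.2) M) Finset.card ⟨∅, by simp⟩
  obtain ⟨hME, hA, hB, hC⟩ := Finset.mem_filter.1 hM
  rw [Finset.mem_powerset] at hME
  suffices H : ∃ T : Finset (A ⊕ B ⊕ C), (∀ e ∈ E, Sum.inl e.1 ∈ T ∨
      Sum.inr (Sum.inl e.2.1) ∈ T ∨ Sum.inr (Sum.inr e.2.2) ∈ T) ∧ T.card ≤ 2 * M.card by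
    obtain ⟨T, hT, hle⟩ := H
    exact ⟨T, M, hME, fun e he f hf hef => ⟨fun h => hef (hA he hf h), fun h => hef (hB he hf h),
      fun h => hef (hC he hf h)⟩, hT, hle⟩
  rcases le_or_gt (Fintype.card A) M.card with hle | hlt
  · refine ⟨Finset.univ.disjSum ∅, fun e _ => .inl (by simp), ?_⟩
    rw [Finset.card_disjSum, Finset.card_univ, Finset.card_empty]
    omega
  choose N hN hNB hNC S T hcover hcard using fun I : Finset A =>
    exists_matching_cover (fun e : A × B × C => e.2.1) (fun e => e.2.2)
      (E.filter fun e => e.1 ∈ I)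
  obtain ⟨I, hI⟩ : ∃ I, (N I).card + 2 * (Fintype.card A - M.card - 1) + 1 < 2 * I.card := by
    by_contra! hall
    obtain ⟨M', hM', hA', hB', hC', hcard'⟩ := exists_rainbow_matching (fun e : A × B × C => e.1)
      _ _ E (Fintype.card A - M.card - 1) fun I => ⟨N I, hN I, hNB I, hNC I, hall I⟩
    have := hmax M' (Finset.mem_filter.2 ⟨Finset.mem_powerset.2 hM', hA', hB', hC'⟩)
    omega
  refine ⟨(Iᶜ).disjSum ((S I).disjSum (T I)), fun e he => ?_, ?_⟩
  · simp only [Finset.inl_mem_disjSum, Finset.inr_mem_disjSum, Finset.mem_compl]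
    by_cases heI : e.1 ∈ I
    · exact .inr (hcover I e (Finset.mem_filter.2 ⟨he, heI⟩))
    · exact .inl heI
  · have h1 := hcard I
    have h2 := I.card_add_card_compl
    rw [Finset.card_disjSum, Finset.card_disjSum]
    omega
end
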